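/- Let E: y² + a₁xy + a₃y = x³ + a₂x² + a₄x with a₁,a₂,a₃,a₄ ∈ ℤ be an elliptic curve (nonzero discriminant Δ), and let p be a prime with p ∤ Δ. If n is a positive integer with p ∤ n, then b(np) ≡ b(n)·b(p) (mod p), where b(n+1) = Σ_{m=⌊n/2⌋}^{n} Σ_{k=0}^{⌊m/2⌋} Σ_{r=0}^{n−m−k} C(m,k)C(m−k,k)C(m−2k,r)C(k,n−m−k−r) a₁^{m−2k−r} a₂^{r} a₃^{2k−n+m+r} a₄^{n−m−k−r}. -/

import Mathlib

open PowerSeries Finset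

/-- `bCoeff a₁ a₂ a₃ a₄ n = b(n+1)`, the coefficient of `zⁿ` in the `z`-expansion of the
invariant differential of `y² + a₁xy + a₃y = x³ + a₂x² + a₄x`. -/
def bCoeff (a₁ a₂ a₃ a₄ : ℤ) (n : ℕ) : ℤ :=
  ∑ m ∈ Finset.Icc (n / 2) n, ∑ k ∈ Finset.range (m / 2 + 1),
    ∑ r ∈ Finset.range (n + 1 - m - k),
      (m.choose k * (m - k).choose k * (m - 2 * k).choose r *
        k.choose (n - m - k - r) : ℤ) *
        a₁ ^ (m - 2 * k - r) * a₂ ^ r * a₃ ^ (2 * k + m + r - n) * a₄ ^ (n - m - k - r)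

theorem mk_centralBinom_sq_mul_one_sub :
    (mk fun n => (n.centralBinom : ℤ)) ^ 2 * (1 - 4 * X) = 1 := by
  set g : ℤ⟦X⟧ := mk fun n => (n.centralBinom : ℤ) with hg
  have hode : derivative ℤ g * (1 - 4 * X) = 2 * g := by
    have h4 : (4 : ℤ⟦X⟧) = C 4 := by simp
    have h2 : (2 : ℤ⟦X⟧) = C 2 := by simp
    have hr : derivative ℤ g * (1 - 4 * X) =
        derivative ℤ g - C 4 * (derivative ℤ g * X) := by rw [h4]; ring
    rw [hr, h2]
    ext n
    rw [map_sub, coeff_C_mul, coeff_C_mul]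
    cases n with
    | zero =>
      simp [coeff_derivative, hg, Nat.centralBinom]
    | succ n =>
      rw [coeff_succ_mul_X, coeff_derivative, coeff_derivative, hg]
      simp only [coeff_mk]
      have h := Nat.succ_mul_centralBinom_succ (n + 1)
      zify at h
      push_cast at h ⊢
      linear_combination h
  apply derivative.ext
  · have h4 : derivative ℤ (4 * X : ℤ⟦X⟧) = 4 := by
      rw [show (4 * X : ℤ⟦X⟧) = (4 : ℤ) • X by rw [zsmul_eq_mul]; simp, map_zsmul, derivative_X,
        zsmul_eq_mul]
      simp
    have h1 : derivative ℤ (1 : ℤ⟦X⟧) = 0 := derivative_one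
    rw [Derivation.leibniz, derivative_pow, map_sub, h4, h1]
    simp only [smul_eq_mul]
    push_cast
    linear_combination 2 * g * hode
  · simp [hg]

theorem coeff_mul_subst {R : Type*} [CommRing R] (φ f w : R⟦X⟧) (hw : (X : R⟦X⟧) ∣ w) (n : ℕ) :
    coeff n (φ * (f.subst w : R⟦X⟧)) =
      ∑ k ∈ range (n + 1), coeff k f * coeff n (φ * w ^ k) := by
  have hs : HasSubst w := HasSubst.of_constantCoeff_zero' (X_dvd_iff.mp hw)
  have hcoeff : ∀ m ≤ n, coeff m (f.subst w : R⟦X⟧) =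
      ∑ k ∈ range (n + 1), coeff k f * coeff m (w ^ k) := by
    intro m hm
    rw [coeff_subst' hs]
    simp only [smul_eq_mul]
    apply finsum_eq_sum_of_support_subset
    intro k hk
    by_contra hkn
    apply hk
    have hlt : m < k := by
      simp only [coe_range, Set.mem_Iio, not_lt] at hkn
      lia
    simp [X_pow_dvd_iff.mp (pow_dvd_pow_of_dvd hw k) m hlt]
  rw [coeff_mul]
  simp only [coeff_mul, mul_sum]
  rw [sum_comm]
  refine sum_congr rfl fun x hx => ?_
  rw [hcoeff x.2 (by have := HasAntidiagonal.mem_antidiagonal.mp hx; lia), mul_sum]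
  exact sum_congr rfl fun k _ => by ring

theorem coeff_C_add_C_mul_X_pow {R : Type*} [CommRing R] (a b : R) (j r : ℕ) :
    coeff r ((C a + C b * X) ^ j) = j.choose r * a ^ (j - r) * b ^ r := by
  have h : ∀ i, (C b * X) ^ i * C a ^ (j - i) * ((j.choose i : ℕ) : R⟦X⟧) =
      C (j.choose i * a ^ (j - i) * b ^ i) * X ^ i := by
    intro i
    simp only [map_mul, map_pow, map_natCast]
    ring
  rw [add_comm, add_pow, map_sum]
  simp only [h, coeff_C_mul, coeff_X_pow]
  simp only [mul_ite, mul_one, mul_zero, sum_ite_eq, mem_range]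
  split_ifs with hr
  · rfl
  · simp [Nat.choose_eq_zero_of_lt (show j < r by lia)]

theorem coeff_linear_mul_quadratic (a₁ a₂ a₃ a₄ : ℤ) (n j k : ℕ) :
    coeff n ((X ^ 3 * (C a₃ + C a₄ * X)) ^ k * (C a₁ * X + C a₂ * X ^ 2 : ℤ⟦X⟧) ^ j) =
      ∑ r ∈ range (n + 1 - (j + 2 * k) - k),
        (j.choose r * k.choose (n - (j + 2 * k) - k - r) : ℤ) *
          a₁ ^ (j - r) * a₂ ^ r * a₃ ^ (2 * k + (j + 2 * k) + r - n) *
          a₄ ^ (n - (j + 2 * k) - k - r) := by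
  have h : (X ^ 3 * (C a₃ + C a₄ * X)) ^ k * (C a₁ * X + C a₂ * X ^ 2 : ℤ⟦X⟧) ^ j =
      X ^ (j + 3 * k) * ((C a₁ + C a₂ * X) ^ j * (C a₃ + C a₄ * X) ^ k) := by
    rw [show (C a₁ * X + C a₂ * X ^ 2 : ℤ⟦X⟧) = X * (C a₁ + C a₂ * X) by ring, mul_pow, mul_pow,
      pow_add, pow_mul]
    ring
  rw [h, coeff_X_pow_mul']
  split_ifs with hn
  · rw [coeff_mul, Nat.sum_antidiagonal_eq_sum_range_succ_mk,
      show n + 1 - (j + 2 * k) - k = n - (j + 3 * k) + 1 by lia]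
    refine sum_congr rfl fun r hr => ?_
    rw [mem_range] at hr
    simp only [coeff_C_add_C_mul_X_pow]
    rw [show n - (j + 2 * k) - k - r = n - (j + 3 * k) - r by lia]
    by_cases hk : k < n - (j + 3 * k) - r
    · simp [Nat.choose_eq_zero_of_lt hk]
    · rw [show 2 * k + (j + 2 * k) + r - n = k - (n - (j + 3 * k) - r) by lia]
      ring
  · rw [show n + 1 - (j + 2 * k) - k = 0 by lia]
    simp

theorem sum_Icc_sum_range_eq_sum_range_sum_range {M : Type*} [AddCommMonoid M] (n : ℕ)
    (T : ℕ → ℕ → M) (hlow : ∀ m k, 2 * k ≤ m → 2 * m < n → T m k = 0)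
    (hhigh : ∀ m k, n < m → T m k = 0) :
    ∑ m ∈ Icc (n / 2) n, ∑ k ∈ range (m / 2 + 1), T m k =
      ∑ k ∈ range (n + 1), ∑ j ∈ range (n + 1), T (j + 2 * k) k := by
  have h1 : ∑ m ∈ Icc (n / 2) n, ∑ k ∈ range (m / 2 + 1), T m k =
      ∑ m ∈ range (n + 1), ∑ k ∈ range (m / 2 + 1), T m k := by
    apply sum_subset
    · intro m hm
      rw [mem_Icc] at hm
      rw [mem_range]
      lia
    · intro m hm hm'
      rw [mem_range] at hm
      rw [mem_Icc] at hm'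
      refine sum_eq_zero fun k hk => hlow m k ?_ ?_
      · rw [mem_range] at hk; lia
      · lia
  rw [h1, sum_sigma', sum_sigma']
  refine sum_of_injOn (fun x => ⟨x.2, x.1 - 2 * x.2⟩) ?_ ?_ ?_ ?_
  · rintro ⟨m, k⟩ hx ⟨m', k'⟩ hy hxy
    simp only [coe_sigma, Set.mem_sigma_iff, coe_range, Set.mem_Iio] at hx hy
    simp only [Sigma.mk.injEq, heq_eq_eq] at hxy ⊢
    lia
  · rintro ⟨m, k⟩ hx
    simp only [coe_sigma, Set.mem_sigma_iff, coe_range, Set.mem_Iio] at hx ⊢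
    lia
  · rintro ⟨k, j⟩ hx hx'
    by_cases hn : n < j + 2 * k
    · exact hhigh _ _ hn
    · refine absurd ⟨⟨j + 2 * k, k⟩, ?_, ?_⟩ hx'
      · simp only [coe_sigma, Set.mem_sigma_iff, coe_range, Set.mem_Iio]
        lia
      · simp
  · rintro ⟨m, k⟩ hx
    simp only [mem_sigma, mem_range] at hx
    simp only
    rw [show m - 2 * k + 2 * k = m by lia]

theorem choose_mul_choose_eq_centralBinom_mul (j k : ℕ) :
    (j + 2 * k).choose k * (j + 2 * k - k).choose k =
      k.centralBinom * (2 * k + j).choose (2 * k) := by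
  have h := Nat.choose_mul (n := 2 * k + j) (k := 2 * k) (s := k) (by lia)
  rw [show 2 * k - k = k by lia] at h
  rw [Nat.centralBinom, mul_comm ((2 * k).choose k), h, add_comm j]

theorem bCoeff_eq_sum (a₁ a₂ a₃ a₄ : ℤ) (n : ℕ) :
    bCoeff a₁ a₂ a₃ a₄ n = ∑ k ∈ range (n + 1), ∑ j ∈ range (n + 1),
      (k.centralBinom * (2 * k + j).choose (2 * k) : ℤ) *
        coeff n ((X ^ 3 * (C a₃ + C a₄ * X)) ^ k * (C a₁ * X + C a₂ * X ^ 2 : ℤ⟦X⟧) ^ j) := by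
  unfold bCoeff
  rw [sum_Icc_sum_range_eq_sum_range_sum_range n (fun m k => ∑ r ∈ Finset.range (n + 1 - m - k),
      (m.choose k * (m - k).choose k * (m - 2 * k).choose r *
        k.choose (n - m - k - r) : ℤ) *
        a₁ ^ (m - 2 * k - r) * a₂ ^ r * a₃ ^ (2 * k + m + r - n) * a₄ ^ (n - m - k - r))]
  · refine sum_congr rfl fun k _ => sum_congr rfl fun j _ => ?_
    rw [coeff_linear_mul_quadratic, mul_sum]
    refine sum_congr rfl fun r _ => ?_
    have h := choose_mul_choose_eq_centralBinom_mul j k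
    zify at h
    rw [h, show j + 2 * k - 2 * k = j by lia]
    ring
  · intro m k hkm hmn
    refine sum_eq_zero fun r hr => ?_
    rw [mem_range] at hr
    by_cases hrm : m - 2 * k < r
    · simp [Nat.choose_eq_zero_of_lt hrm]
    · simp [Nat.choose_eq_zero_of_lt (show k < n - m - k - r by lia)]
  · intro m k hnm
    rw [show n + 1 - m - k = 0 - k by lia]
    simp

/-- The generating function of `bCoeff` is an inverse square root of a quartic polynomial. -/
theorem mk_bCoeff_sq_mul (a₁ a₂ a₃ a₄ : ℤ) :
    mk (bCoeff a₁ a₂ a₃ a₄) ^ 2 * ((1 - (C a₁ * X + C a₂ * X ^ 2)) ^ 2 -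
      4 * (X ^ 3 * (C a₃ + C a₄ * X))) = 1 := by
  set u : ℤ⟦X⟧ := C a₁ * X + C a₂ * X ^ 2 with hu
  set v : ℤ⟦X⟧ := X ^ 3 * (C a₃ + C a₄ * X) with hv
  have hXu : X ∣ u := ⟨C a₁ + C a₂ * X, by rw [hu]; ring⟩
  have hXv : X ∣ v := ⟨X ^ 2 * (C a₃ + C a₄ * X), by rw [hv]; ring⟩
  have hsu : HasSubst u := HasSubst.of_constantCoeff_zero' (X_dvd_iff.mp hXu)
  set I : ℤ⟦X⟧ := (mk 1 : ℤ⟦X⟧).subst u with hI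
  have hI1 : I * (1 - u) = 1 := by
    have h := congrArg (substAlgHom hsu) (mk_one_mul_one_sub_eq_one ℤ)
    rwa [map_mul, map_sub, map_one, substAlgHom_X, coe_substAlgHom] at h
  have hIpow : ∀ d : ℕ, I ^ (d + 1) =
      ((mk fun n => (Nat.choose (d + n) d : ℤ) : ℤ⟦X⟧).subst u : ℤ⟦X⟧) := by
    intro d
    rw [← mk_one_pow_eq_mk_choose_add, hI, subst_pow hsu]
  have hXw : X ∣ v * I ^ 2 := hXv.mul_right _
  have hsw : HasSubst (v * I ^ 2) := HasSubst.of_constantCoeff_zero' (X_dvd_iff.mp hXw)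
  set G : ℤ⟦X⟧ := (mk fun n => (n.centralBinom : ℤ) : ℤ⟦X⟧).subst (v * I ^ 2) with hG
  have hG1 : G ^ 2 * (1 - 4 * (v * I ^ 2)) = 1 := by
    have h := congrArg (substAlgHom hsw) mk_centralBinom_sq_mul_one_sub
    rwa [map_mul, map_sub, map_mul, map_one, map_pow, map_ofNat, substAlgHom_X,
      coe_substAlgHom] at h
  have hF : mk (bCoeff a₁ a₂ a₃ a₄) = I * G := by
    ext n
    rw [coeff_mk, hG, coeff_mul_subst _ _ _ hXw, bCoeff_eq_sum]
    refine sum_congr rfl fun k _ => ?_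
    rw [show I * (v * I ^ 2) ^ k = v ^ k * I ^ (2 * k + 1) by
      rw [mul_pow, ← pow_mul, pow_succ]; ring, hIpow, coeff_mul_subst _ _ _ hXu, mul_sum]
    refine sum_congr rfl fun j _ => ?_
    rw [coeff_mk, coeff_mk]
    ring
  rw [hF]
  linear_combination hG1 + G ^ 2 * (I * (1 - u) + 1) * hI1

theorem pow_eq_expand {p : ℕ} [Fact p.Prime] (f : (ZMod p)⟦X⟧) :
    f ^ p = expand p (Fact.out : p.Prime).ne_zero f := by
  have h := MvPowerSeries.map_frobenius_expand (R := ZMod p) (σ := Unit) p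
    (Fact.out : p.Prime).ne_zero (f := f)
  rw [ZMod.frobenius_zmod] at h
  rw [← h]
  exact congrFun (congrArg DFunLike.coe (MvPowerSeries.map_id (σ := Unit) (R := ZMod p))) _

theorem coeff_mul_expand {R : Type*} [CommRing R] {p : ℕ} (hp : p ≠ 0) (H : Polynomial R)
    (hH : H.natDegree ≤ 2 * p - 2) (f : R⟦X⟧) (n : ℕ) :
    coeff ((n + 1) * p - 1) ((H : R⟦X⟧) * expand p hp f) = H.coeff (p - 1) * coeff n f := by
  have hadd : p - 1 + p * n = (n + 1) * p - 1 := by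
    have : (n + 1) * p = p + p * n := by ring
    lia
  rw [coeff_mul, sum_eq_single (p - 1, p * n)]
  · simp
  · rintro ⟨i, j⟩ hij hne
    rw [HasAntidiagonal.mem_antidiagonal] at hij
    simp only [Polynomial.coeff_coe] at hij ⊢
    by_cases hpj : p ∣ j
    · obtain ⟨t, rfl⟩ := hpj
      rcases lt_trichotomy t n with h | h | h
      · have : p * (t + 1) ≤ p * n := Nat.mul_le_mul_left p h
        rw [mul_add] at this
        rw [Polynomial.coeff_eq_zero_of_natDegree_lt (by lia), zero_mul]
      · subst h
        exact absurd (by rw [Prod.mk.injEq]; exact ⟨by lia, rfl⟩) hne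
      · have : p * (n + 1) ≤ p * t := Nat.mul_le_mul_left p h
        rw [mul_add] at this
        lia
    · rw [coeff_expand_of_not_dvd p hp f hpj, mul_zero]
  · intro h
    exact absurd (HasAntidiagonal.mem_antidiagonal.mpr hadd) h

theorem exists_polynomial_mul_expand {p : ℕ} [Fact p.Prime] (A B : Polynomial (ZMod p))
    (hA : A.natDegree ≤ 2) (hB : B.natDegree ≤ 4) (f : (ZMod p)⟦X⟧)
    (hf : f ^ 2 * ((A : (ZMod p)⟦X⟧) ^ 2 - 4 * (B : (ZMod p)⟦X⟧)) = 1) :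
    ∃ H : Polynomial (ZMod p), H.natDegree ≤ 2 * p - 2 ∧
      f = (H : (ZMod p)⟦X⟧) * expand p (Fact.out : p.Prime).ne_zero f := by
  have hp : p.Prime := Fact.out
  rcases hp.eq_two_or_odd' with rfl | ⟨k, hk⟩
  · refine ⟨A, hA, ?_⟩
    have h2 : (2 : (ZMod 2)⟦X⟧) = 0 := by
      rw [show (2 : (ZMod 2)⟦X⟧) = C (2 : ZMod 2) from (map_ofNat C 2).symm, show (2 : ZMod 2) = 0 from rfl, map_zero]
    have h1 : f * (A : (ZMod 2)⟦X⟧) = 1 := by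
      rw [← sub_eq_zero, ← sq_eq_zero_iff]
      linear_combination hf + (1 - f * (A : (ZMod 2)⟦X⟧) + 2 * f ^ 2 * (B : (ZMod 2)⟦X⟧)) * h2
    rw [← pow_eq_expand]
    linear_combination -f * h1
  · refine ⟨(A ^ 2 - 4 * B) ^ k, ?_, ?_⟩
    · have hQ : (A ^ 2 - 4 * B).natDegree ≤ 4 := by
        refine (Polynomial.natDegree_sub_le _ _).trans (max_le ?_ ?_)
        · exact Polynomial.natDegree_pow_le_of_le 2 hA
        · rw [show (4 : Polynomial (ZMod p)) = Polynomial.C 4 from (map_ofNat Polynomial.C 4).symm]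
          exact (Polynomial.natDegree_C_mul_le _ _).trans hB
      have := Polynomial.natDegree_pow_le_of_le k hQ
      lia
    · rw [← pow_eq_expand]
      rw [show f ^ p = (f ^ 2) ^ k * f by rw [← pow_mul, ← pow_succ, ← hk], Polynomial.coe_pow, ← mul_assoc, ← mul_pow]
      rw [show ((A ^ 2 - 4 * B : Polynomial (ZMod p)) : (ZMod p)⟦X⟧) * f ^ 2 = 1 by
        rw [← hf, Polynomial.coe_sub, Polynomial.coe_pow, Polynomial.coe_mul,
          show ((4 : Polynomial (ZMod p)) : (ZMod p)⟦X⟧) = 4 from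
            map_ofNat Polynomial.coeToPowerSeries.ringHom 4]
        ring]
      rw [one_pow, one_mul]

theorem stmt6 (a₁ a₂ a₃ a₄ : ℤ)
    (hΔ : (WeierstrassCurve.mk a₁ a₂ a₃ a₄ 0).Δ ≠ 0)
    (p : ℕ) (hp : p.Prime) (hpΔ : ¬ ((p : ℤ) ∣ (WeierstrassCurve.mk a₁ a₂ a₃ a₄ 0).Δ))
    (b : ℕ → ℤ) (hb : ∀ n : ℕ, 1 ≤ n → b n = bCoeff a₁ a₂ a₃ a₄ (n - 1))
    (n : ℕ) (hn : 0 < n) (hpn : ¬ p ∣ n) :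
    b (n * p) ≡ b n * b p [ZMOD p] := by
  have : Fact p.Prime := ⟨hp⟩
  obtain ⟨A, hA⟩ : ∃ A : Polynomial (ZMod p), A = 1 - (Polynomial.C (a₁ : ZMod p) * Polynomial.X +
    Polynomial.C (a₂ : ZMod p) * Polynomial.X ^ 2) := ⟨_, rfl⟩
  obtain ⟨B, hB⟩ : ∃ B : Polynomial (ZMod p), B = Polynomial.X ^ 3 * (Polynomial.C (a₃ : ZMod p) +
    Polynomial.C (a₄ : ZMod p) * Polynomial.X) := ⟨_, rfl⟩
  have hA2 : A.natDegree ≤ 2 := by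
    rw [hA]
    compute_degree
  have hB4 : B.natDegree ≤ 4 := by
    rw [hB]
    compute_degree
  have hAs : (A : (ZMod p)⟦X⟧) = 1 - (C (a₁ : ZMod p) * X + C (a₂ : ZMod p) * X ^ 2) := by
    simp only [hA, Polynomial.coe_sub, Polynomial.coe_add, Polynomial.coe_mul, Polynomial.coe_pow,
      Polynomial.coe_one, Polynomial.coe_C, Polynomial.coe_X]
  have hBs : (B : (ZMod p)⟦X⟧) = X ^ 3 * (C (a₃ : ZMod p) + C (a₄ : ZMod p) * X) := by
    simp only [hB, Polynomial.coe_add, Polynomial.coe_mul, Polynomial.coe_pow,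
      Polynomial.coe_C, Polynomial.coe_X]
  have hf := congrArg (map (Int.castRingHom (ZMod p))) (mk_bCoeff_sq_mul a₁ a₂ a₃ a₄)
  have hcf : ∀ m, coeff m (map (Int.castRingHom (ZMod p)) (mk (bCoeff a₁ a₂ a₃ a₄))) =
      (bCoeff a₁ a₂ a₃ a₄ m : ZMod p) := fun m => by simp
  simp only [map_mul, map_pow, map_sub, map_add, map_one, map_ofNat, map_C, map_X,
    Int.coe_castRingHom] at hf
  rw [← hAs, ← hBs] at hf
  generalize map (Int.castRingHom (ZMod p)) (mk (bCoeff a₁ a₂ a₃ a₄)) = f at hf hcf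
  obtain ⟨H, hH, hfH⟩ := exists_polynomial_mul_expand A B hA2 hB4 f hf
  have hcoeff : ∀ m : ℕ, (b ((m + 1) * p) : ZMod p) = H.coeff (p - 1) * (b (m + 1) : ZMod p) := by
    intro m
    have h := coeff_mul_expand hp.ne_zero H hH f m
    rw [← hfH, hcf, hcf] at h
    rw [hb _ (Nat.mul_pos m.succ_pos hp.pos), hb _ m.succ_pos]
    exact h
  have hb1 : b 1 = 1 := by
    rw [hb 1 le_rfl]
    simp [bCoeff]
  obtain ⟨m, rfl⟩ := Nat.exists_eq_succ_of_ne_zero hn.ne'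
  have h1 := hcoeff 0
  rw [zero_add, one_mul, hb1, Int.cast_one, mul_one] at h1
  rw [← ZMod.intCast_eq_intCast_iff, Int.cast_mul, h1, mul_comm _ (H.coeff _)]
  exact hcoeff m
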